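/- arXiv:1612.08128 — 10 statements merged into one kernel-verified Lean document; each statement's English description precedes it below -/
import Mathlib

section
/- Let X be a compact metric space and let A and B be two disjoint closed subsets of X. Then either there exists a compact connected subset C of X with C ∩ A ≠ ∅ and C ∩ B ≠ ∅, or X can be written as X = X_A ∪ X_B where X_A and X_B are disjoint compact subsets of X with A ⊆ X_A and B ⊆ X_B. -/
/-- If `p x U` holds for some clopen `U` around each point `x` of a compact set `K`, where the
clopen sets satisfying `p` are stable under finite unions, then some such clopen contains `K`. -/
theorem IsCompact.exists_isClopen_superset {X : Type*} [TopologicalSpace X] {K : Set X}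
    (hK : IsCompact K) {p : Set X → Prop} (hp : p ∅) (hunion : ∀ U V, p U → p V → p (U ∪ V))
    (h : ∀ x ∈ K, ∃ U, IsClopen U ∧ x ∈ U ∧ p U) : ∃ U, IsClopen U ∧ K ⊆ U ∧ p U := by
  refine hK.induction_on (p := fun S => ∃ U, IsClopen U ∧ S ⊆ U ∧ p U)
    ⟨∅, isClopen_empty, subset_rfl, hp⟩ ?_ ?_ ?_
  · rintro s t hst ⟨U, hU, htU, hpU⟩
    exact ⟨U, hU, hst.trans htU, hpU⟩
  · rintro s t ⟨U, hU, hsU, hpU⟩ ⟨V, hV, htV, hpV⟩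
    exact ⟨U ∪ V, hU.union hV, Set.union_subset_union hsU htV, hunion U V hpU hpV⟩
  · intro x hx
    obtain ⟨U, hU, hxU, hpU⟩ := h x hx
    exact ⟨U, mem_nhdsWithin_of_mem_nhds (hU.isOpen.mem_nhds hxU), U, hU, subset_rfl, hpU⟩

/-- In a compact Hausdorff space, two compact sets that no connected component meets
simultaneously are separated by a clopen set. -/
theorem exists_isClopen_separating_of_connectedComponent {X : Type*} [TopologicalSpace X]
    [T2Space X] [CompactSpace X] {A B : Set X} (hA : IsCompact A) (hB : IsCompact B)
    (h : ∀ a ∈ A, ∀ b ∈ B, b ∉ connectedComponent a) :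
    ∃ U, IsClopen U ∧ A ⊆ U ∧ Disjoint U B := by
  refine hA.exists_isClopen_superset (p := fun U => Disjoint U B) (Set.empty_disjoint B)
    (fun U V hU hV => hU.union_left hV) fun a ha => ?_
  obtain ⟨V, hV, hBV, haV⟩ : ∃ V, IsClopen V ∧ B ⊆ V ∧ a ∉ V := by
    refine hB.exists_isClopen_superset (p := fun V => a ∉ V) (Set.notMem_empty a)
      (fun U V hU hV => by simp [hU, hV]) fun b hb => ?_
    have hab := h a ha b hb
    rw [connectedComponent_eq_iInter_isClopen, Set.mem_iInter, not_forall] at hab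
    obtain ⟨⟨W, hW, haW⟩, hbW⟩ := hab
    exact ⟨Wᶜ, hW.compl, hbW, by simpa using haW⟩
  exact ⟨Vᶜ, hV.compl, haV, disjoint_compl_left.mono_right hBV⟩

/-- **Separation Lemma.** Let `X` be a compact metric space and `A`, `B` two disjoint
closed subsets of `X`. Then either there exists a subcontinuum (compact connected subset)
`C` of `X` meeting both `A` and `B`, or `X = X_A ∪ X_B` with `X_A`, `X_B` disjoint compact
sets containing `A` and `B` respectively. -/
theorem stmt_0 {X : Type*} [MetricSpace X] [CompactSpace X]
    (A B : Set X) (hA : IsClosed A) (hB : IsClosed B) (hAB : Disjoint A B) :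
    (∃ C : Set X, IsCompact C ∧ IsConnected C ∧ (C ∩ A).Nonempty ∧ (C ∩ B).Nonempty) ∨
    (∃ XA XB : Set X, IsCompact XA ∧ IsCompact XB ∧ Disjoint XA XB ∧
      XA ∪ XB = Set.univ ∧ A ⊆ XA ∧ B ⊆ XB) := by
  by_cases h : ∃ a ∈ A, ∃ b ∈ B, b ∈ connectedComponent a
  · obtain ⟨a, ha, b, hb, hab⟩ := h
    exact Or.inl ⟨connectedComponent a, isClosed_connectedComponent.isCompact,
      isConnected_connectedComponent, ⟨a, mem_connectedComponent, ha⟩, ⟨b, hab, hb⟩⟩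
  · push Not at h
    obtain ⟨U, hU, hAU, hUB⟩ :=
      exists_isClopen_separating_of_connectedComponent hA.isCompact hB.isCompact h
    exact Or.inr ⟨U, Uᶜ, hU.isClosed.isCompact, hU.compl.isClosed.isCompact,
      disjoint_compl_right, Set.union_compl_self U, hAU, hUB.subset_compl_left⟩
end

section
/- Let X be a topological space and A ⊆ X a closed subset such that the pair (X, A) has the homotopy extension property. Let B ⊆ A be a closed subset which is a strong deformation retract of A. Then the quotient spaces X/A and X/B are homotopy equivalent. -/
open unitInterval

/-- The quotient space `X/A` obtained from `X` by collapsing the subset `A` to a single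
point, with the quotient topology. -/
def Collapse {X : Type u} [TopologicalSpace X] (A : Set X) : Type u :=
  Quot (fun x y : X => x = y ∨ (x ∈ A ∧ y ∈ A))

instance {X : Type u} [TopologicalSpace X] (A : Set X) : TopologicalSpace (Collapse A) :=
  inferInstanceAs (TopologicalSpace (Quot _))

/-- The pair `(X, A)` has the homotopy extension property: every continuous map defined
on the subspace `(X × {0}) ∪ (A × [0,1])` of `X × [0,1]` with values in an arbitrary
topological space `Y` extends to a continuous map `X × [0,1] → Y`. -/
def HasHEP {X : Type u} [TopologicalSpace X] (A : Set X) : Prop :=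
  ∀ (Y : Type u) [TopologicalSpace Y]
    (f : {p : X × unitInterval // p.2 = 0 ∨ p.1 ∈ A} → Y), Continuous f →
    ∃ F : X × unitInterval → Y, Continuous F ∧ ∀ p, F p.val = f p

namespace Collapse

variable {X : Type u} [TopologicalSpace X] {A B : Set X}

/-- The quotient map `X → X/A`. -/
def mk (A : Set X) (x : X) : Collapse A :=
  Quot.mk _ x

theorem continuous_mk (A : Set X) : Continuous (mk A) :=
  continuous_quot_mk

theorem mk_eq_mk {x y : X} (hx : x ∈ A) (hy : y ∈ A) : mk A x = mk A y :=
  Quot.sound (Or.inr ⟨hx, hy⟩)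

theorem ind {p : Collapse A → Prop} (h : ∀ x, p (mk A x)) (z : Collapse A) : p z :=
  Quot.ind h z

/-- The map `X/A → Y` induced by a continuous map `X → Y` that is constant on `A`. -/
def lift {Y : Type*} [TopologicalSpace Y] (f : C(X, Y))
    (hf : ∀ x ∈ A, ∀ y ∈ A, f x = f y) : C(Collapse A, Y) where
  toFun := Quot.lift f (by
    rintro x y (rfl | ⟨hx, hy⟩)
    exacts [rfl, hf x hx y hy])
  continuous_toFun := continuous_quot_lift _ f.continuous

/-- The map `X/A → X/B` induced by a continuous map of pairs `(X, A) → (X, B)`. -/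
def map (f : C(X, X)) (hf : Set.MapsTo f A B) : C(Collapse A, Collapse B) :=
  lift ⟨fun x => mk B (f x), (continuous_mk B).comp f.continuous⟩
    fun _ hx _ hy => mk_eq_mk (hf hx) (hf hy)

/-- A homotopy of `X` starting at the identity and preserving `A` descends to `X/A`. -/
theorem homotopic_id_of_mapsTo (F : C(X × unitInterval, X)) (h0 : ∀ x, F (x, 0) = x)
    (hF : ∀ x ∈ A, ∀ t, F (x, t) ∈ A) (g : C(Collapse A, Collapse A))
    (hg : ∀ x, g (mk A x) = mk A (F (x, 1))) : g.Homotopic (ContinuousMap.id _) := by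
  let G : C(X × unitInterval, Collapse A) :=
    ⟨fun p => mk A (F p), (continuous_mk A).comp F.continuous⟩
  let K : C(Collapse A, C(unitInterval, Collapse A)) := lift G.curry fun x hx y hy => by
    ext t
    exact mk_eq_mk (hF x hx t) (hF y hy t)
  refine ContinuousMap.Homotopic.symm ⟨⟨⟨fun p => K p.2 p.1, by fun_prop⟩, ?_, ?_⟩⟩
  · exact ind fun x => congrArg (mk A) (h0 x)
  · exact ind fun x => (hg x).symm

end Collapse

/-- The homotopy extension property extends a homotopy of the inclusion `A → X` to a homotopy
of the identity of `X`. -/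
theorem HasHEP.exists_extension {X : Type u} [TopologicalSpace X] {A : Set X} (hHEP : HasHEP A)
    (hA : IsClosed A) (H : ↥A × unitInterval → ↥A) (Hcont : Continuous H)
    (H0 : ∀ a : ↥A, H (a, 0) = a) :
    ∃ F : C(X × unitInterval, X), (∀ x, F (x, 0) = x) ∧
      ∀ (a : ↥A) (t : unitInterval), F (a, t) = H (a, t) := by
  classical
  let f : {p : X × unitInterval // p.2 = 0 ∨ p.1 ∈ A} → X := fun p =>
    if h : p.1.1 ∈ A then H (⟨p.1.1, h⟩, p.1.2) else p.1.1
  have f0 : ∀ p, p.1.2 = 0 → f p = p.1.1 := fun p hp => by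
    by_cases h : p.1.1 ∈ A <;> simp [f, h, hp, H0]
  have fA : ∀ p (h : p.1.1 ∈ A), f p = H (⟨p.1.1, h⟩, p.1.2) := fun p h => dif_pos h
  have fcont : Continuous f := by
    let S : Set {p : X × unitInterval // p.2 = 0 ∨ p.1 ∈ A} := {p | p.1.2 = 0}
    let T : Set {p : X × unitInterval // p.2 = 0 ∨ p.1 ∈ A} := {p | p.1.1 ∈ A}
    have hS : IsClosed S := isClosed_eq (by fun_prop) continuous_const
    have hT : IsClosed T := hA.preimage (by fun_prop)
    have cS : ContinuousOn f S := by
      have : Continuous fun p : {p : X × unitInterval // p.2 = 0 ∨ p.1 ∈ A} => p.1.1 := by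
        fun_prop
      exact this.continuousOn.congr f0
    have cT : ContinuousOn f T := by
      rw [continuousOn_iff_continuous_domRestrict]
      have : Continuous fun p : T => (H (⟨p.1.1.1, p.2⟩, p.1.1.2) : X) := by fun_prop
      exact this.congr fun p => (fA p.1 p.2).symm
    rw [← continuousOn_univ, ← Set.eq_univ_of_forall (s := S ∪ T) fun p => p.2]
    exact cS.union_of_isClosed cT hS hT
  obtain ⟨F, Fcont, hF⟩ := hHEP X f fcont
  refine ⟨⟨F, Fcont⟩, fun x => ?_, fun a t => ?_⟩
  · exact (hF ⟨(x, 0), Or.inl rfl⟩).trans (f0 _ rfl)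
  · exact (hF ⟨(a, t), Or.inr a.2⟩).trans (fA _ a.2)

/-- If the pair `(X, A)` (with `A` closed) has the homotopy extension property and the
closed subset `B ⊆ A` is a strong deformation retract of `A`, then `X/A ≃ X/B`
(homotopy equivalence). -/
theorem stmt_1 {X : Type u} [TopologicalSpace X] (A B : Set X)
    (hA : IsClosed A) (hB : IsClosed B) (hBA : B ⊆ A)
    (hHEP : HasHEP A)
    (H : ↥A × unitInterval → ↥A) (Hcont : Continuous H)
    (H0 : ∀ a : ↥A, H (a, 0) = a)
    (H1 : ∀ a : ↥A, (H (a, 1) : X) ∈ B)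
    (Hfix : ∀ b : ↥A, (b : X) ∈ B → ∀ t : unitInterval, H (b, t) = b) :
    Nonempty (ContinuousMap.HomotopyEquiv (Collapse A) (Collapse B)) := by
  obtain ⟨F, F0, FH⟩ := hHEP.exists_extension hA H Hcont H0
  have FA : ∀ x ∈ A, ∀ t, F (x, t) ∈ A := fun x hx t => by
    rw [FH ⟨x, hx⟩ t]
    exact (H _).2
  have FB : ∀ x ∈ B, ∀ t, F (x, t) ∈ B := fun x hx t => by
    rw [FH ⟨x, hBA hx⟩ t, Hfix _ hx]
    exact hx
  have FAB : ∀ x ∈ A, F (x, 1) ∈ B := fun x hx => by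
    rw [FH ⟨x, hx⟩ 1]
    exact H1 _
  exact ⟨{
    toFun := Collapse.map ⟨fun x => F (x, 1), by fun_prop⟩ FAB
    invFun := Collapse.map (ContinuousMap.id X) hBA
    left_inv := Collapse.homotopic_id_of_mapsTo F F0 FA _ fun _ => rfl
    right_inv := Collapse.homotopic_id_of_mapsTo F F0 FB _ fun _ => rfl }⟩
end

section
/- Let X be a topological space and A ⊆ X a closed subset such that the pair (X, A) has the homotopy extension property, and let B ⊆ A be a closed subset. Let π_B : X → X/B be the quotient projection. Then the pair (X/B, π_B(A)) has the homotopy extension property. -/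
open unitInterval

/-- The canonical projection `X → X/B`. -/
def Collapse.proj {X : Type u} [TopologicalSpace X] (B : Set X) : X → Collapse B :=
  Quot.mk _

/-- If the pair `(X, A)` (with `A` closed) has the homotopy extension property and
`B ⊆ A` is closed, then the pair `(X/B, π_B(A))` has the homotopy extension property,
where `π_B : X → X/B` is the quotient projection. -/
theorem stmt_2 {X : Type u} [TopologicalSpace X] (A B : Set X)
    (hA : IsClosed A) (hB : IsClosed B) (hBA : B ⊆ A)
    (hHEP : HasHEP A) :
    HasHEP (Collapse.proj B '' A) := by
  intro Y _ f hf
  have hproj : Topology.IsQuotientMap (Collapse.proj B) := isQuotientMap_quot_mk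
  let g : {p : X × unitInterval // p.2 = 0 ∨ p.1 ∈ A} → Y := fun p =>
    f ⟨(Collapse.proj B p.val.1, p.val.2), p.property.imp_right (Set.mem_image_of_mem _)⟩
  have hg : Continuous g := by
    refine hf.comp (Continuous.subtype_mk ?_ _)
    exact (hproj.continuous.comp (continuous_fst.comp continuous_subtype_val)).prodMk
      (continuous_snd.comp continuous_subtype_val)
  obtain ⟨F, hF, hFg⟩ := hHEP Y g hg
  have hcompat (t : unitInterval) (x y : X) (h : x = y ∨ (x ∈ B ∧ y ∈ B)) :
      F (x, t) = F (y, t) := by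
    obtain rfl | hxy := h
    · rfl
    · have hπ : Collapse.proj B x = Collapse.proj B y := Quot.sound (Or.inr hxy)
      rw [hFg ⟨(x, t), Or.inr (hBA hxy.1)⟩, hFg ⟨(y, t), Or.inr (hBA hxy.2)⟩]
      simp only [g, hπ]
  let G : Collapse B × unitInterval → Y := fun p =>
    Quot.lift (fun x => F (x, p.2)) (hcompat p.2) p.1
  refine ⟨G, hproj.continuous_lift_prod_left hF, ?_⟩
  rintro ⟨⟨q, t⟩, ht | ⟨a, ha, hq⟩⟩
  · obtain ⟨x, rfl⟩ := hproj.surjective q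
    exact hFg ⟨(x, t), Or.inl ht⟩
  · dsimp only at hq
    subst hq
    exact hFg ⟨(a, t), Or.inr ha⟩
end

section
/- Let X be a metric space, let (K_n) be a sequence of nonempty compact connected subsets of X, and let K be a nonempty compact subset of X such that the Hausdorff distance δ_H(K_n, K) tends to 0 as n → ∞. Then K is connected. -/
open Metric in
/-- A compact set that has preconnected sets arbitrarily close to it in Hausdorff distance
is preconnected. -/
theorem IsCompact.isPreconnected_of_forall_hausdorffEDist_lt {X : Type*} [EMetricSpace X]
    {L : Set X} (hL : IsCompact L)
    (h : ∀ δ : ℝ, 0 < δ → ∃ S : Set X, IsPreconnected S ∧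
      hausdorffEDist S L < ENNReal.ofReal δ) :
    IsPreconnected L := by
  rw [isPreconnected_closed_iff]
  intro u v hu hv hLuv hLu hLv
  by_contra hempty
  have hdisj : Disjoint (L ∩ u) (L ∩ v) := by
    rw [Set.disjoint_left]
    exact fun x hxu hxv => hempty ⟨x, hxu.1, hxu.2, hxv.2⟩
  obtain ⟨δ, hδ, hthick⟩ :=
    hdisj.exists_thickenings (hL.inter_right hu) (hL.inter_right hv).isClosed
  obtain ⟨S, hS, hSL⟩ := h δ hδ
  have hcover : S ⊆ thickening δ (L ∩ u) ∪ thickening δ (L ∩ v) := by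
    intro x hx
    obtain ⟨y, hy, hxy⟩ := exists_edist_lt_of_hausdorffEDist_lt hx hSL
    exact (hLuv hy).imp
      (fun hyu => (mem_thickening_iff_exists_edist_lt _ _).2 ⟨y, ⟨hy, hyu⟩, hxy⟩)
      (fun hyv => (mem_thickening_iff_exists_edist_lt _ _).2 ⟨y, ⟨hy, hyv⟩, hxy⟩)
  have hmeet : ∀ A ⊆ L, A.Nonempty → (S ∩ thickening δ A).Nonempty := by
    rintro A hA ⟨y, hy⟩
    rw [hausdorffEDist_comm] at hSL
    obtain ⟨x, hx, hyx⟩ := exists_edist_lt_of_hausdorffEDist_lt (hA hy) hSL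
    exact ⟨x, hx, (mem_thickening_iff_exists_edist_lt _ _).2 ⟨y, hy, by rwa [edist_comm]⟩⟩
  obtain ⟨x, -, hxu, hxv⟩ := hS _ _ isOpen_thickening isOpen_thickening hcover
    (hmeet _ Set.inter_subset_left hLu) (hmeet _ Set.inter_subset_left hLv)
  exact Set.disjoint_left.1 hthick hxu hxv

/-- If a sequence `K n` of nonempty compact connected subsets of a metric space converges
in Hausdorff distance to a nonempty compact set `L`, then `L` is connected. -/
theorem stmt_4 {X : Type*} [MetricSpace X] (K : ℕ → Set X) (L : Set X)
    (hKcpt : ∀ n, IsCompact (K n)) (hKne : ∀ n, (K n).Nonempty)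
    (hKconn : ∀ n, IsConnected (K n))
    (hLcpt : IsCompact L) (hLne : L.Nonempty)
    (hconv : Filter.Tendsto (fun n => Metric.hausdorffDist (K n) L)
      Filter.atTop (nhds 0)) :
    IsConnected L := by
  refine ⟨hLne, hLcpt.isPreconnected_of_forall_hausdorffEDist_lt fun δ hδ => ?_⟩
  obtain ⟨n, hn⟩ := (hconv.eventually_lt_const hδ).exists
  refine ⟨K n, (hKconn n).isPreconnected, ?_⟩
  have hfin := Metric.hausdorffEDist_ne_top_of_nonempty_of_bounded (hKne n) hLne
    (hKcpt n).isBounded hLcpt.isBounded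
  exact (ENNReal.lt_ofReal_iff_toReal_lt hfin).2 hn
end

section
/- Let X be a compact metric space and let C and K be closed subsets of X. Then the union of all connected components of C (with respect to the subspace topology on C) that intersect K is a closed subset of X. -/
/-- In a compact Hausdorff space, the union of the connected components meeting a closed set is
closed. -/
theorem isClosed_preimage_image_connectedComponents {Y : Type*} [TopologicalSpace Y]
    [CompactSpace Y] [T2Space Y] {K : Set Y} (hK : IsClosed K) :
    IsClosed (((↑) : Y → ConnectedComponents Y) ⁻¹' ((↑) '' K)) :=
  ((hK.isCompact.image ConnectedComponents.continuous_coe).isClosed).preimage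
    ConnectedComponents.continuous_coe

/-- The union of the connected components of `C` meeting `K`, as the image of a saturation in the
subspace `C`. -/
theorem biUnion_connectedComponentIn_eq_image {X : Type*} [TopologicalSpace X] (C K : Set X) :
    (⋃ x ∈ {x ∈ C | (connectedComponentIn C x ∩ K).Nonempty}, connectedComponentIn C x) =
      ((↑) : C → X) '' (((↑) : C → ConnectedComponents C) ⁻¹' ((↑) '' (((↑) : C → X) ⁻¹' K))) := by
  ext y
  simp only [Set.mem_iUnion, Set.mem_ofPred_eq, exists_prop, Set.mem_image, Set.mem_preimage]
  constructor
  · rintro ⟨x, ⟨hx, z, hz, hzK⟩, hy⟩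
    rw [connectedComponentIn_eq_image hx] at hz hy
    obtain ⟨z, hz, rfl⟩ := hz
    obtain ⟨y, hy, rfl⟩ := hy
    exact ⟨y, ⟨z, hzK, ConnectedComponents.coe_eq_coe.2
      ((connectedComponent_eq hz).symm.trans (connectedComponent_eq hy))⟩, rfl⟩
  · rintro ⟨y, ⟨z, hzK, hzy⟩, rfl⟩
    refine ⟨y, ⟨y.2, z, ?_, hzK⟩, mem_connectedComponentIn y.2⟩
    rw [connectedComponentIn_eq_image y.2]
    exact ⟨z, ConnectedComponents.coe_eq_coe'.1 hzy, rfl⟩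

/-- In a compact metric space `X`, for closed subsets `C` and `K`, the union of those
connected components of `C` (in the subspace topology) that intersect `K` is closed. -/
theorem stmt_5 {X : Type*} [MetricSpace X] [CompactSpace X]
    (C K : Set X) (hC : IsClosed C) (hK : IsClosed K) :
    IsClosed (⋃ x ∈ {x ∈ C | (connectedComponentIn C x ∩ K).Nonempty},
      connectedComponentIn C x) := by
  have : CompactSpace C := isCompact_iff_compactSpace.1 hC.isCompact
  rw [biUnion_connectedComponentIn_eq_image]
  exact hC.isClosedMap_subtype_val _ (isClosed_preimage_image_connectedComponents
    (hK.preimage continuous_subtype_val))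
end

section
/- Let X and Λ be metric spaces and let Φ : [0,∞) × X × Λ → X be a continuous map such that for each fixed λ ∈ Λ, Φ(0, x, λ) = x and Φ(t + s, x, λ) = Φ(t, Φ(s, x, λ), λ) for all x ∈ X and s, t ≥ 0 (i.e. Φ(·,·,λ) is a global semiflow for each λ). Suppose λ_n → λ₀ in Λ, each K_n is a nonempty compact subset of X which is invariant for the parameter λ_n (Φ(t, ·, λ_n)(K_n) = K_n for all t ≥ 0), and K_n converges in Hausdorff distance to a nonempty compact set K. Then K is invariant for the parameter λ₀: Φ(t, ·, λ₀)(K) = K for all t ≥ 0. -/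
open scoped NNReal

open Filter Topology in
/-- Points taken from two sequences of sets at Hausdorff distance tending to zero can be matched
up to an error tending to zero. -/
theorem exists_mem_tendsto_dist_zero {X : Type*} [PseudoMetricSpace X] {A B : ℕ → Set X}
    (hfin : ∀ n, Metric.hausdorffEDist (A n) (B n) ≠ ⊤)
    (hconv : Tendsto (fun n => Metric.hausdorffDist (A n) (B n)) atTop (𝓝 0))
    {u : ℕ → X} (hu : ∀ n, u n ∈ A n) :
    ∃ v : ℕ → X, (∀ n, v n ∈ B n) ∧ Tendsto (fun n => dist (u n) (v n)) atTop (𝓝 0) := by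
  have h : ∀ n, ∃ y ∈ B n,
      dist (u n) y < Metric.hausdorffDist (A n) (B n) + 1 / ((n : ℝ) + 1) := fun n =>
    Metric.exists_dist_lt_of_hausdorffDist_lt (hu n)
      (lt_add_of_pos_right _ Nat.one_div_pos_of_nat) (hfin n)
  choose v hv hd using h
  refine ⟨v, hv, squeeze_zero (fun _ => dist_nonneg) (fun n => (hd n).le) ?_⟩
  simpa using hconv.add (tendsto_one_div_add_atTop_nhds_zero_nat (𝕜 := ℝ))

open Filter Topology in
/-- A compact Hausdorff limit of nonempty compact sets `K n`, each invariant under `F n`, is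
invariant under the continuous limit `f` of the maps `F n`. -/
theorem image_eq_of_tendsto_hausdorffDist {X : Type*} [MetricSpace X]
    {F : ℕ → X → X} {f : X → X}
    (hF : ∀ x, Tendsto (fun p : ℕ × X => F p.1 p.2) (atTop ×ˢ 𝓝 x) (𝓝 (f x)))
    {K : ℕ → Set X} (hKne : ∀ n, (K n).Nonempty) (hKcpt : ∀ n, IsCompact (K n))
    (hKinv : ∀ n, F n '' K n = K n)
    {M : Set X} (hMne : M.Nonempty) (hMcpt : IsCompact M)
    (hconv : Tendsto (fun n => Metric.hausdorffDist (K n) M) atTop (𝓝 0)) :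
    f '' M = M := by
  have hfin : ∀ n, Metric.hausdorffEDist (K n) M ≠ ⊤ := fun n =>
    Metric.hausdorffEDist_ne_top_of_nonempty_of_bounded (hKne n) hMne
      (hKcpt n).isBounded hMcpt.isBounded
  have approx : ∀ x ∈ M, ∃ u : ℕ → X, (∀ n, u n ∈ K n) ∧ Tendsto u atTop (𝓝 x) := by
    intro x hx
    obtain ⟨u, hu, hd⟩ := exists_mem_tendsto_dist_zero (A := fun _ => M) (B := K)
      (fun n => by rw [Metric.hausdorffEDist_comm]; exact hfin n)
      (by simpa only [Metric.hausdorffDist_comm] using hconv) (u := fun _ => x) (fun _ => hx)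
    exact ⟨u, hu, tendsto_iff_dist_tendsto_zero.2 (by simpa only [dist_comm] using hd)⟩
  apply Set.Subset.antisymm
  · rintro _ ⟨x, hx, rfl⟩
    obtain ⟨u, hu, hux⟩ := approx x hx
    have hFu : ∀ n, F n (u n) ∈ K n := fun n => hKinv n ▸ Set.mem_image_of_mem _ (hu n)
    have hlim : Tendsto (fun n => F n (u n)) atTop (𝓝 (f x)) :=
      (hF x).comp (tendsto_id.prodMk hux)
    obtain ⟨v, hv, hd⟩ := exists_mem_tendsto_dist_zero (B := fun _ => M) hfin hconv hFu
    exact hMcpt.isClosed.mem_of_tendsto (hlim.congr_dist hd) (Eventually.of_forall hv)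
  · intro y hy
    obtain ⟨u, hu, huy⟩ := approx y hy
    have hpre : ∀ n, ∃ w ∈ K n, F n w = u n := fun n => by
      have := hu n
      rwa [← hKinv n] at this
    choose w hw hwu using hpre
    obtain ⟨v, hv, hd⟩ := exists_mem_tendsto_dist_zero (B := fun _ => M) hfin hconv hw
    obtain ⟨m, hm, φ, hφ, hvm⟩ := hMcpt.tendsto_subseq hv
    have hwm : Tendsto (w ∘ φ) atTop (𝓝 m) := by
      refine hvm.congr_dist ?_
      simpa only [Function.comp_def, dist_comm] using hd.comp hφ.tendsto_atTop
    have hlim : Tendsto (fun k => F (φ k) (w (φ k))) atTop (𝓝 (f m)) :=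
      (hF m).comp (hφ.tendsto_atTop.prodMk hwm)
    simp only [hwu] at hlim
    exact ⟨m, hm, tendsto_nhds_unique hlim (huy.comp hφ.tendsto_atTop)⟩

/-- Let `Φ : [0,∞) × X × Λ → X` be a continuous family of global semiflows on a metric
space `X` with parameters in a metric space `Λ`. If `λ_n → λ₀`, each `K n` is a nonempty
compact set invariant for the parameter `λ_n`, and `K n → L` in Hausdorff distance with
`L` nonempty compact, then `L` is invariant for the parameter `λ₀`. -/
theorem stmt_7 {X L : Type*} [MetricSpace X] [MetricSpace L]
    (Φ : ℝ≥0 → X → L → X)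
    (hcont : Continuous fun p : ℝ≥0 × X × L => Φ p.1 p.2.1 p.2.2)
    (hzero : ∀ x l, Φ 0 x l = x)
    (hadd : ∀ t s x l, Φ (t + s) x l = Φ t (Φ s x l) l)
    (lam : ℕ → L) (l0 : L) (hlam : Filter.Tendsto lam Filter.atTop (nhds l0))
    (K : ℕ → Set X) (hKne : ∀ n, (K n).Nonempty) (hKcpt : ∀ n, IsCompact (K n))
    (hKinv : ∀ n t, (fun x => Φ t x (lam n)) '' K n = K n)
    (M : Set X) (hMne : M.Nonempty) (hMcpt : IsCompact M)
    (hconv : Filter.Tendsto (fun n => Metric.hausdorffDist (K n) M)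
      Filter.atTop (nhds 0)) :
    ∀ t, (fun x => Φ t x l0) '' M = M := by
  intro t
  refine image_eq_of_tendsto_hausdorffDist (F := fun n x => Φ t x (lam n)) (fun x => ?_)
    hKne hKcpt (fun n => hKinv n t) hMne hMcpt hconv
  exact (hcont.tendsto (t, x, l0)).comp (tendsto_const_nhds.prodMk_nhds
    (Filter.tendsto_snd.prodMk_nhds (hlam.comp Filter.tendsto_fst)))
end

section
/- Let φ be a global semiflow on a topological space X and let p ∈ X satisfy φ(t,p) = p for all t ≥ 0. Let G ⊆ X be a set with p ∈ G which is positively invariant (φ(t,·)(G) ⊆ G for all t ≥ 0) and which is uniformly attracted to p: for every neighborhood V of p there exists T ≥ 0 such that φ(t,·)(G) ⊆ V for all t ≥ T. Then G, equipped with the subspace topology, is a contractible space; indeed H(s,x) = φ(s/(1−s), x) for s ∈ [0,1) and H(1,x) = p defines a homotopy on G × [0,1] from the identity of G to the constant map p. -/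
open scoped NNReal unitInterval

/-- The contracting homotopy `H(x, s) = φ(s/(1-s), x)` for `s ∈ [0,1)`, `H(x, 1) = p`,
defined on `G × [0,1]` (with values in the ambient space `X`). -/
noncomputable def contractionMap {X : Type*} (φ : ℝ≥0 → X → X) (p : X) (G : Set X)
    (q : ↥G × I) : X :=
  if (q.2 : ℝ) < 1 then φ (Real.toNNReal ((q.2 : ℝ) / (1 - (q.2 : ℝ)))) (q.1 : X) else p

/-- The time `s / (1 - s)` tends to infinity as `s` increases to `1`. -/
theorem eventually_le_toNNReal_div_one_sub (T : ℝ≥0) {s₀ : I} (hs₀ : ¬ (s₀ : ℝ) < 1) :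
    ∀ᶠ s : I in nhds s₀, (s : ℝ) < 1 → T ≤ Real.toNNReal ((s : ℝ) / (1 - (s : ℝ))) := by
  have hT : (T : ℝ) / (1 + T) < s₀ :=
    lt_of_lt_of_le ((div_lt_one (by positivity)).2 (by linarith)) (not_lt.1 hs₀)
  filter_upwards [continuous_subtype_val.continuousAt.eventually (lt_mem_nhds hT)] with s hs h1
  rw [Real.le_toNNReal_iff_coe_le (div_nonneg s.2.1 (by linarith)), le_div_iff₀ (by linarith)]
  rw [div_lt_iff₀ (by positivity)] at hs
  linarith

theorem continuous_contractionMap {X : Type*} [TopologicalSpace X] {φ : ℝ≥0 → X → X}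
    (hcont : Continuous fun q : ℝ≥0 × X => φ q.1 q.2) {p : X} {G : Set X}
    (hattr : ∀ V ∈ nhds p, ∃ T : ℝ≥0, ∀ t ≥ T, ∀ x ∈ G, φ t x ∈ V) :
    Continuous (contractionMap φ p G) := by
  refine continuous_iff_continuousAt.2 fun q => ?_
  by_cases hq : (q.2 : ℝ) < 1
  · have hne : 1 - (q.2 : ℝ) ≠ 0 := by linarith
    have hflow : ContinuousAt (fun r : ↥G × I =>
        φ (Real.toNNReal ((r.2 : ℝ) / (1 - (r.2 : ℝ)))) (r.1 : X)) q := by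
      have htime : ContinuousAt (fun r : ↥G × I =>
          Real.toNNReal ((r.2 : ℝ) / (1 - (r.2 : ℝ)))) q :=
        continuous_real_toNNReal.continuousAt.comp
          (ContinuousAt.div (by fun_prop) (by fun_prop) hne)
      have hpoint : ContinuousAt (fun r : ↥G × I => (r.1 : X)) q := by fun_prop
      exact hcont.continuousAt.comp (htime.prodMk hpoint)
    refine hflow.congr ?_
    have hopen : IsOpen {r : ↥G × I | (r.2 : ℝ) < 1} :=
      isOpen_lt (by fun_prop) continuous_const
    filter_upwards [hopen.mem_nhds hq] with r hr
    exact (if_pos hr).symm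
  · intro V hV
    rw [contractionMap, if_neg hq] at hV
    rw [Filter.mem_map]
    obtain ⟨T, hT⟩ := hattr V hV
    have hlarge := (continuous_snd (X := ↥G)).continuousAt.eventually
      (eventually_le_toNNReal_div_one_sub T hq)
    filter_upwards [hlarge] with r hr
    rw [Set.mem_preimage, contractionMap]
    split_ifs with h1
    · exact hT _ (hr h1) _ r.1.2
    · exact mem_of_mem_nhds hV

/-- Let `φ` be a global semiflow on a topological space `X`, `p` an equilibrium, and
`G ∋ p` a positively invariant set uniformly attracted to `p`. Then
`H(s,x) = φ(s/(1-s), x)` for `s ∈ [0,1)`, `H(1,x) = p` defines a homotopy on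
`G × [0,1]` from the identity of `G` to the constant map `p`; in particular `G` (with
the subspace topology) is contractible. -/
theorem stmt_10 {X : Type*} [TopologicalSpace X] (φ : ℝ≥0 → X → X)
    (hcont : Continuous fun q : ℝ≥0 × X => φ q.1 q.2)
    (hzero : ∀ x, φ 0 x = x) (hadd : ∀ t s x, φ (t + s) x = φ t (φ s x))
    (p : X) (hp : ∀ t, φ t p = p)
    (G : Set X) (hpG : p ∈ G)
    (hGinv : ∀ t, φ t '' G ⊆ G)
    (hattr : ∀ V ∈ nhds p, ∃ T : ℝ≥0, ∀ t ≥ T, ∀ x ∈ G, φ t x ∈ V) :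
    Continuous (contractionMap φ p G) ∧
    (∀ q : ↥G × I, contractionMap φ p G q ∈ G) ∧
    (∀ x : ↥G, contractionMap φ p G (x, 0) = (x : X)) ∧
    (∀ x : ↥G, contractionMap φ p G (x, 1) = p) ∧
    ContractibleSpace ↥G := by
  have hH := continuous_contractionMap hcont hattr
  have hmem : ∀ q : ↥G × I, contractionMap φ p G q ∈ G := by
    intro q
    rw [contractionMap]
    split_ifs
    · exact hGinv _ ⟨_, q.1.2, rfl⟩
    · exact hpG
  have h0 : ∀ x : ↥G, contractionMap φ p G (x, 0) = (x : X) := by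
    simp [contractionMap, hzero]
  have h1 : ∀ x : ↥G, contractionMap φ p G (x, 1) = p := by
    simp [contractionMap]
  refine ⟨hH, hmem, h0, h1, (contractible_iff_id_nullhomotopic _).2 ⟨⟨p, hpG⟩, ⟨?_⟩⟩⟩
  exact
    { toFun := fun q => ⟨contractionMap φ p G q.swap, hmem _⟩
      continuous_toFun := (hH.comp continuous_swap).subtype_mk _
      map_zero_left := fun x => Subtype.ext (h0 x)
      map_one_left := fun x => Subtype.ext (h1 x) }
end

section
/- Let X be a compact Hausdorff topological space, let M ⊆ X be a closed path-connected subset, and let h : [0,1] → X be a topological embedding with h(0), h(1) ∈ M, h(0) ≠ h(1), h((0,1)) ∩ M = ∅, and X = M ∪ h([0,1]). Then X is path-connected but not simply connected: the loop obtained by traversing the arc h from h(0) to h(1) and then a path in M from h(1) back to h(0) is not null-homotopic in X; in particular the fundamental group of X is nontrivial. -/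
open scoped unitInterval

/-- The map collapsing `M` to the base point of the circle and winding the arc `h` once around. -/
theorem exists_continuousMap_addCircle_of_arc {X : Type*} [TopologicalSpace X] [T2Space X]
    {M : Set X} (hMcl : IsClosed M) {h : I → X} (hemb : Topology.IsEmbedding h)
    (hdisj : (h '' {s : I | 0 < (s : ℝ) ∧ (s : ℝ) < 1}) ∩ M = ∅)
    (hcover : M ∪ Set.range h = Set.univ) :
    ∃ f : C(X, AddCircle (1 : ℝ)), (∀ x ∈ M, f x = 0) ∧
      ∀ t, f (h t) = ((t : ℝ) : AddCircle (1 : ℝ)) := by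
  let c : I → AddCircle (1 : ℝ) := fun t ↦ ((t : ℝ) : AddCircle (1 : ℝ))
  have hc : Continuous c := (AddCircle.continuous_mk' (1 : ℝ)).comp continuous_subtype_val
  let f : X → AddCircle (1 : ℝ) := Function.extend h c 0
  have fh (t : I) : f (h t) = c t := hemb.injective.extend_apply c 0 t
  have fM : ∀ x ∈ M, f x = 0 := by
    intro x hx
    by_cases hr : ∃ t, h t = x
    · obtain ⟨t, rfl⟩ := hr
      rw [fh]
      rcases t.2.1.eq_or_lt with h0 | h0
      · simp [c, ← h0]
      rcases t.2.2.eq_or_lt with h1 | h1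
      · simp only [c, h1]
        exact AddCircle.coe_period (1 : ℝ)
      · exact (hdisj.subset ⟨⟨t, ⟨h0, h1⟩, rfl⟩, hx⟩).elim
    · exact Function.extend_apply' _ _ _ hr
  have contM : ContinuousOn f M := continuousOn_const.congr fM
  have contR : ContinuousOn f (Set.range h) := by
    rw [continuousOn_iff_continuous_domRestrict]
    rw [← hemb.toHomeomorph.comp_continuous_iff']
    exact hc.congr fun t ↦ (fh t).symm
  have cont : Continuous f := by
    rw [← continuousOn_univ, ← hcover]
    exact contM.union_of_isClosed contR hMcl (isCompact_range hemb.continuous).isClosed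
  exact ⟨⟨f, cont⟩, fM, fh⟩

/-- A loop winding once around the circle along the first path and staying at the base point
along the second one is not null-homotopic. -/
theorem not_homotopic_refl_of_winding {X : Type*} [TopologicalSpace X] {x y : X}
    (f : C(X, AddCircle (1 : ℝ))) (α : Path x y) (γ : Path y x)
    (hα : ∀ t, f (α t) = ((t : ℝ) : AddCircle (1 : ℝ))) (hγ : ∀ t, f (γ t) = 0) :
    ¬ (α.trans γ).Homotopic (Path.refl x) := by
  intro hhom
  have cov := AddCircle.isCoveringMap_coe (1 : ℝ)
  have hx : f x = ((0 : ℝ) : AddCircle (1 : ℝ)) := by simpa using hα 0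
  have hrel : (f.comp (α.trans γ).toContinuousMap).HomotopicRel
      (f.comp (Path.refl x).toContinuousMap) {0, 1} :=
    ContinuousMap.HomotopicRel.comp_continuousMap hhom f
  have h₀ : f.comp (α.trans γ).toContinuousMap 0 = ((0 : ℝ) : AddCircle (1 : ℝ)) := by
    simpa using hx
  have h₁ : f.comp (Path.refl x).toContinuousMap 0 = ((0 : ℝ) : AddCircle (1 : ℝ)) := by
    simpa using hx
  have key := cov.liftPath_apply_one_eq_of_homotopicRel hrel 0 h₀ h₁
  have lift₀ : (⟨fun t : I ↦ min (2 * (t : ℝ)) 1, by fun_prop⟩ : C(I, ℝ)) =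
      cov.liftPath _ 0 h₀ := by
    rw [cov.eq_liftPath_iff']
    refine ⟨funext fun t ↦ ?_, by simp⟩
    change ((min (2 * (t : ℝ)) 1 : ℝ) : AddCircle (1 : ℝ)) = f (α.trans γ t)
    rw [Path.trans_apply]
    split_ifs with ht
    · rw [hα, min_eq_left (by linarith)]
    · rw [hγ, min_eq_right (by linarith)]
      exact AddCircle.coe_period (1 : ℝ)
  have lift₁ : ContinuousMap.const I (0 : ℝ) = cov.liftPath _ 0 h₁ := by
    rw [cov.eq_liftPath_iff']
    exact ⟨funext fun t ↦ hx.symm, rfl⟩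
  rw [← lift₀, ← lift₁] at key
  norm_num at key

/-- Let `X` be a compact Hausdorff space, `M ⊆ X` a closed path-connected subset, and
`h : [0,1] → X` an embedding with `h 0, h 1 ∈ M`, `h 0 ≠ h 1`, `h((0,1)) ∩ M = ∅` and
`X = M ∪ h([0,1])`. Then `X` is path-connected but not simply connected: the loop
obtained by traversing the arc `h` and then a path in `M` from `h 1` back to `h 0` is
not null-homotopic; in particular the fundamental group of `X` is nontrivial. -/
theorem stmt_12 {X : Type*} [TopologicalSpace X] [CompactSpace X] [T2Space X]
    (M : Set X) (hMcl : IsClosed M) (hMpc : IsPathConnected M)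
    (h : I → X) (hemb : Topology.IsEmbedding h)
    (h0M : h 0 ∈ M) (h1M : h 1 ∈ M) (hne : h 0 ≠ h 1)
    (hdisj : (h '' {s : I | 0 < (s : ℝ) ∧ (s : ℝ) < 1}) ∩ M = ∅)
    (hcover : M ∪ Set.range h = Set.univ) :
    PathConnectedSpace X ∧
    (∀ γ : Path (h 1) (h 0), (∀ t, γ t ∈ M) →
      ¬ ((Path.mk ⟨h, hemb.continuous⟩ rfl rfl).trans γ).Homotopic
          (Path.refl (h 0))) ∧
    ¬ SimplyConnectedSpace X := by
  obtain ⟨f, fM, fh⟩ := exists_continuousMap_addCircle_of_arc hMcl hemb hdisj hcover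
  have loop (γ : Path (h 1) (h 0)) (hγ : ∀ t, γ t ∈ M) :
      ¬ ((Path.mk ⟨h, hemb.continuous⟩ rfl rfl).trans γ).Homotopic (Path.refl (h 0)) :=
    not_homotopic_refl_of_winding f _ γ fh fun t ↦ fM _ (hγ t)
  refine ⟨?_, loop, fun _ ↦ ?_⟩
  · have : PathConnectedSpace I := isPathConnected_iff_pathConnectedSpace.mp
      ((convex_Icc (0 : ℝ) 1).isPathConnected ⟨0, unitInterval.zero_mem⟩)
    rw [pathConnectedSpace_iff_univ, ← hcover]
    exact hMpc.union (isPathConnected_range hemb.continuous) ⟨h 0, h0M, 0, rfl⟩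
  · obtain ⟨γ, hγ⟩ := hMpc.joinedIn _ h1M _ h0M
    exact loop γ hγ (SimplyConnectedSpace.paths_homotopic _ _)
end

section
/- Let E be a real normed vector space, F : E → E a continuous map, V : E → ℝ a differentiable function, and a ∈ ℝ. Assume that the derivative of V in the direction of the vector field F is strictly negative on the level set {V = a}, i.e. DV(x)[F(x)] < 0 for every x ∈ E with V(x) = a. If γ : [0,T] → E is differentiable with γ'(t) = F(γ(t)) for all t ∈ [0,T] and V(γ(0)) ≤ a, then V(γ(t)) ≤ a for all t ∈ [0,T]; in other words, the sublevel set {x ∈ E : V(x) ≤ a} is positively invariant for solutions of the differential equation x' = F(x). -/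
/-- Let `E` be a real normed space, `F : E → E` continuous, `V : E → ℝ` differentiable,
and `a ∈ ℝ` with `DV(x)[F(x)] < 0` whenever `V x = a`. If `γ : [0,T] → E` solves
`γ' = F ∘ γ` and `V (γ 0) ≤ a`, then `V (γ t) ≤ a` for all `t ∈ [0,T]`: the sublevel
set `{V ≤ a}` is positively invariant for the equation `x' = F(x)`. -/
theorem stmt_13 {E : Type*} [NormedAddCommGroup E] [NormedSpace ℝ E]
    (F : E → E) (hF : Continuous F) (V : E → ℝ) (hV : Differentiable ℝ V) (a : ℝ)
    (hlevel : ∀ x, V x = a → fderiv ℝ V x (F x) < 0)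
    (T : ℝ) (γ : ℝ → E)
    (hγ : ∀ t ∈ Set.Icc 0 T, HasDerivWithinAt γ (F (γ t)) (Set.Icc 0 T) t)
    (hstart : V (γ 0) ≤ a) :
    ∀ t ∈ Set.Icc 0 T, V (γ t) ≤ a := by
  have hderiv : ∀ t ∈ Set.Icc 0 T,
      HasDerivWithinAt (fun s => V (γ s)) (fderiv ℝ V (γ t) (F (γ t))) (Set.Icc 0 T) t :=
    fun t ht => (hV (γ t)).hasFDerivAt.comp_hasDerivWithinAt t (hγ t ht)
  exact image_le_of_deriv_right_lt_deriv_boundary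
    (fun t ht => (hderiv t ht).continuousWithinAt)
    (fun t ht => (hderiv t (Set.Ico_subset_Icc_self ht)).mono_of_mem_nhdsWithin
      (Icc_mem_nhdsGE_of_mem ht))
    hstart (fun t => hasDerivAt_const t a) (fun t _ h => hlevel (γ t) h)
end

section
/- Let φ be a global semiflow on a metric space X and let B ⊆ X be a nonempty compact set which is positively invariant: φ(t,·)(B) ⊆ B for all t ≥ 0. Then S := ⋂_{t≥0} φ(t,·)(B) is a nonempty compact invariant set (φ(t,·)(S) = S for all t ≥ 0), S contains every invariant subset of B (it is the maximal invariant set in B), and S attracts B: for every open set U ⊇ S there exists T ≥ 0 such that φ(t,·)(B) ⊆ U for all t ≥ T. In particular S is an attractor of φ whenever B is a neighborhood of S. -/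
open scoped NNReal

theorem antitone_image_of_semiflow {X : Type*} {φ : ℝ≥0 → X → X}
    (hadd : ∀ t s x, φ (t + s) x = φ t (φ s x)) {B : Set X} (hBinv : ∀ t, φ t '' B ⊆ B) :
    Antitone fun t => φ t '' B := by
  rintro s t hst _ ⟨b, hb, rfl⟩
  refine ⟨φ (t - s) b, hBinv _ ⟨b, hb, rfl⟩, ?_⟩
  rw [← hadd, add_tsub_cancel_of_le hst]

/-- Let `φ` be a global semiflow on a metric space `X` and `B` a nonempty compact
positively invariant set. Then `S = ⋂_{t ≥ 0} φ t '' B` is a nonempty compact invariant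
set, it is the maximal invariant set in `B`, and it attracts `B`. In particular `S` is
an attractor whenever `B` is a neighborhood of `S`. -/
theorem stmt_14 {X : Type*} [MetricSpace X] (φ : ℝ≥0 → X → X)
    (hcont : Continuous fun q : ℝ≥0 × X => φ q.1 q.2)
    (hzero : ∀ x, φ 0 x = x) (hadd : ∀ t s x, φ (t + s) x = φ t (φ s x))
    (B : Set X) (hBne : B.Nonempty) (hBcpt : IsCompact B)
    (hBinv : ∀ t, φ t '' B ⊆ B) :
    (⋂ t : ℝ≥0, φ t '' B).Nonempty ∧
    IsCompact (⋂ t : ℝ≥0, φ t '' B) ∧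
    (∀ t, φ t '' (⋂ s : ℝ≥0, φ s '' B) = ⋂ s : ℝ≥0, φ s '' B) ∧
    (∀ M : Set X, M ⊆ B → (∀ t, φ t '' M = M) → M ⊆ ⋂ s : ℝ≥0, φ s '' B) ∧
    (∀ U : Set X, IsOpen U → (⋂ s : ℝ≥0, φ s '' B) ⊆ U →
      ∃ T : ℝ≥0, ∀ t ≥ T, φ t '' B ⊆ U) ∧
    ((∀ x ∈ ⋂ s : ℝ≥0, φ s '' B, B ∈ nhds x) →
      ∃ U : Set X, (∀ x ∈ ⋂ s : ℝ≥0, φ s '' B, U ∈ nhds x) ∧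
        ∀ V : Set X, IsOpen V → (⋂ s : ℝ≥0, φ s '' B) ⊆ V →
          ∃ T : ℝ≥0, ∀ t ≥ T, φ t '' U ⊆ V) := by
  have hφ (t : ℝ≥0) : Continuous (φ t) := hcont.comp (Continuous.prodMk_right t)
  have hanti := antitone_image_of_semiflow hadd hBinv
  have hdir : Directed (· ⊇ ·) fun t => φ t '' B := hanti.directed_ge
  have hcpt (t : ℝ≥0) : IsCompact (φ t '' B) := hBcpt.image (hφ t)
  have hclosed (t : ℝ≥0) : IsClosed (φ t '' B) := (hcpt t).isClosed
  have hattr (U : Set X) (hU : IsOpen U) (hSU : (⋂ s : ℝ≥0, φ s '' B) ⊆ U) :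
      ∃ T : ℝ≥0, ∀ t ≥ T, φ t '' B ⊆ U := by
    obtain ⟨T, hT⟩ := exists_subset_nhds_of_isCompact' hdir hcpt hclosed
      fun x hx => hU.mem_nhds (hSU hx)
    exact ⟨T, fun t ht => (hanti ht).trans hT⟩
  refine ⟨IsCompact.nonempty_iInter_of_directed_nonempty_isCompact_isClosed _ hdir
    (fun t => hBne.image _) hcpt hclosed,
    (hcpt 0).of_isClosed_subset (isClosed_iInter hclosed) (Set.iInter_subset _ 0),
    fun t => Set.Subset.antisymm ?_ ?_, ?_, hattr, fun hB => ⟨B, hB, hattr⟩⟩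
  · rintro _ ⟨x, hx, rfl⟩
    refine Set.mem_iInter.2 fun s => ?_
    obtain ⟨b, hb, rfl⟩ := Set.mem_iInter.1 hx s
    exact ⟨φ t b, hBinv t ⟨b, hb, rfl⟩, by rw [← hadd, ← hadd, add_comm]⟩
  · intro y hy
    have hfiber : IsClosed (φ t ⁻¹' {y}) := isClosed_singleton.preimage (hφ t)
    have hK : Antitone fun s => φ s '' B ∩ φ t ⁻¹' {y} :=
      fun _ _ h => Set.inter_subset_inter_left _ (hanti h)
    obtain ⟨x, hx⟩ := IsCompact.nonempty_iInter_of_directed_nonempty_isCompact_isClosed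
      (fun s => φ s '' B ∩ φ t ⁻¹' {y}) hK.directed_ge
      (fun s => by
        obtain ⟨b, hb, rfl⟩ := Set.mem_iInter.1 hy (t + s)
        exact ⟨φ s b, ⟨b, hb, rfl⟩, (hadd t s b).symm⟩)
      (fun s => (hcpt s).inter_right hfiber) (fun s => (hclosed s).inter hfiber)
    rw [Set.mem_iInter] at hx
    exact ⟨x, Set.mem_iInter.2 fun s => (hx s).1, (hx 0).2⟩
  · intro M hM hMinv
    refine Set.subset_iInter fun s => ?_
    rw [← hMinv s]
    exact Set.image_mono hM
end
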